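/- (Greene) Let M be a matrix over GF(2) with finite row set V and finite column set E whose rows are linearly independent, let λ be a nonzero real number, and set γ = 1/λ − 1. Then Σ_{w ∈ Υ} λ^{wt(w)} = λ^{|E|} · Σ_{A⊆E} γ^{|A|} · 2^{|V| − rank(M_A)}, where Υ is the linear subspace of GF(2)^E spanned by the rows of M. -/

import Mathlib

open Matrix

/-- The number of vectors in the left kernel of a matrix over a finite field. -/
theorem Matrix.card_filter_vecMul_eq_zero {K m n : Type*} [Field K] [Fintype K] [DecidableEq K]
    [Fintype m] [DecidableEq m] [Fintype n] (N : Matrix m n K) :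
    (Finset.univ.filter fun x : m → K => x ᵥ* N = 0).card
      = Fintype.card K ^ (Fintype.card m - N.rank) := by
  have hker : Module.finrank K (LinearMap.ker Nᵀ.mulVecLin) = Fintype.card m - N.rank := by
    have h := LinearMap.finrank_range_add_finrank_ker Nᵀ.mulVecLin
    rw [Module.finrank_fintype_fun_eq_card] at h
    rw [← Matrix.rank_transpose N, Matrix.rank]
    omega
  have hcard := Module.natCard_eq_pow_finrank (K := K) (V := LinearMap.ker Nᵀ.mulVecLin)
  rw [hker, Nat.card_eq_fintype_card (α := K)] at hcard
  rw [← hcard, ← Fintype.card_subtype, ← Nat.card_eq_fintype_card]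
  exact Nat.card_congr (Equiv.subtypeEquivRight fun x => by simp)

/-- The weight monomial of a vector, expanded over the sets of coordinates on which it vanishes. -/
theorem pow_card_support_eq_sum {K R E : Type*} [Field K] [DecidableEq R] [Zero R] [Fintype E]
    [DecidableEq E] {c : K} (hc : c ≠ 0) (w : E → R) :
    c ^ (Finset.univ.filter fun e => w e ≠ 0).card
      = c ^ Fintype.card E *
        ∑ A : Finset E, if ∀ e ∈ A, w e = 0 then (1 / c - 1) ^ A.card else 0 := by
  have hsum : (∑ A : Finset E, if ∀ e ∈ A, w e = 0 then (1 / c - 1) ^ A.card else 0)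
      = (1 / c) ^ (Finset.univ.filter fun e => w e = 0).card := by
    have h := Finset.sum_pow_mul_eq_add_pow (1 / c - 1) 1 (Finset.univ.filter fun e => w e = 0)
    simp only [one_pow, mul_one, sub_add_cancel] at h
    rw [← h, ← Finset.sum_filter]
    refine Finset.sum_congr ?_ fun _ _ => rfl
    ext A
    simp [Finset.subset_iff]
  have hcard := Finset.card_filter_add_card_filter_not (s := (Finset.univ : Finset E))
    (fun e => w e = 0)
  rw [hsum, ← Finset.card_univ, ← hcard, pow_add, one_div, inv_pow]
  field_simp

/-- Greene: For a generating matrix `M` over GF(2) with linearly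
independent rows, and `λ ≠ 0`, `γ = 1/λ − 1`, the weight enumerator of the code `Υ`
generated by the rows of `M` satisfies
`Σ_{w∈Υ} λ^{wt(w)} = λ^{|E|} Σ_{A⊆E} γ^{|A|} 2^{|V| − rank(M_A)}`. -/
theorem stmt10 {V E : Type} [Fintype V] [Fintype E] [DecidableEq V] [DecidableEq E]
    (M : Matrix V E (ZMod 2))
    (hrows : LinearIndependent (ZMod 2) (fun i : V => M i))
    (lam γ : ℝ) (hlam : lam ≠ 0) (hγ : γ = 1 / lam - 1) :
    ∑ w ∈ (Set.toFinite
        ((Submodule.span (ZMod 2) (Set.range fun i : V => M i) : Set (E → ZMod 2)))).toFinset,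
        lam ^ (Finset.univ.filter (fun e : E => w e ≠ 0)).card
      = lam ^ (Fintype.card E) *
          ∑ A : Finset E, γ ^ A.card *
            (2 : ℝ) ^ (Fintype.card V -
              (M.submatrix id (fun a : {x // x ∈ A} => (a : E))).rank) := by
  have himage : (Set.toFinite ((Submodule.span (ZMod 2) (Set.range fun i : V => M i) :
      Set (E → ZMod 2)))).toFinset = Finset.univ.image fun x : V → ZMod 2 => x ᵥ* M := by
    ext w
    simp only [Set.Finite.mem_toFinset, SetLike.mem_coe, Finset.mem_image, Finset.mem_univ,
      true_and, Submodule.mem_span_range_iff_exists_fun, Matrix.vecMul_eq_sum]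
  rw [himage, Finset.sum_image (Matrix.vecMul_injective_iff.mpr hrows).injOn]
  simp_rw [pow_card_support_eq_sum hlam, ← hγ]
  rw [← Finset.mul_sum, Finset.sum_comm]
  congr 1
  refine Finset.sum_congr rfl fun A _ => ?_
  rw [← Finset.sum_filter, Finset.sum_const, nsmul_eq_mul, mul_comm]
  have hcard := Matrix.card_filter_vecMul_eq_zero
    (M.submatrix id (fun a : {x // x ∈ A} => (a : E)))
  rw [ZMod.card] at hcard
  rw [← Nat.cast_ofNat (R := ℝ), ← Nat.cast_pow, ← hcard]
  congr 3
  ext x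
  simp [funext_iff, Matrix.vecMul, Matrix.submatrix, dotProduct]
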